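/- arXiv:2106.02955 — 5 statements merged into one kernel-verified Lean document; each statement's English description precedes it below -/
import Mathlib

section
/- Every sparse symmetric shifted ideal J in the polynomial ring Z has linear quotients. -/
open MvPolynomial

/-- The sparse squarefree monomial `z^μ = ∏_{i : μ i > 0} z_{i, μ i}`, where the variable
`z_{i,j}` (for `1 ≤ j ≤ b`) is represented by `X (i, j-1)`. -/
noncomputable def sparseMon (K : Type*) [Field K] (s b : ℕ) (μ : Fin s → ℕ) :
    MvPolynomial (Fin s × Fin b) K :=
  ∏ i : Fin s, ∏ j : Fin b, if μ i = (j : ℕ) + 1 then X (i, j) else 1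

/-- `μ' ≤₀ μ`. -/
def leZero {s : ℕ} (μ' μ : Fin s → ℕ) : Prop :=
  ∀ i, μ' i ≤ μ i ∧ (μ' i = 0 ↔ μ i = 0)

/-- The action of `σ ∈ S_s` on `Z`, sending `z_{i,j}` to `z_{σ i, j}`. -/
noncomputable def permMap (K : Type*) [Field K] (s b : ℕ) (σ : Equiv.Perm (Fin s)) :
    MvPolynomial (Fin s × Fin b) K →ₐ[K] MvPolynomial (Fin s × Fin b) K :=
  rename fun p => (σ p.1, p.2)

/-- `z^μ` is a minimal monomial generator of the monomial ideal `J`. -/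
def IsMinSparseGen (K : Type*) [Field K] (s b : ℕ)
    (J : Ideal (MvPolynomial (Fin s × Fin b) K)) (μ : Fin s → ℕ) : Prop :=
  (∀ i, μ i ≤ b) ∧ sparseMon K s b μ ∈ J ∧
    ∀ i, 0 < μ i → sparseMon K s b (Function.update μ i 0) ∉ J

/-- A proper monomial ideal `J` of `Z` is sparse symmetric shifted if (S-1) it is generated
by sparse squarefree monomials, (S-2) for every minimal monomial generator `z^μ` and every
`μ' ≤₀ μ` one has `z^{μ'} ∈ J`, and (S-3) `σ(J) = J` for every permutation `σ`. -/
def IsSSS (K : Type*) [Field K] (s b : ℕ)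
    (J : Ideal (MvPolynomial (Fin s × Fin b) K)) : Prop :=
  J ≠ ⊤ ∧
  (∃ S : Set (Fin s → ℕ), (∀ μ ∈ S, ∀ i, μ i ≤ b) ∧
      J = Ideal.span (sparseMon K s b '' S)) ∧
  (∀ μ : Fin s → ℕ, IsMinSparseGen K s b J μ →
      ∀ μ' : Fin s → ℕ, leZero μ' μ → sparseMon K s b μ' ∈ J) ∧
  (∀ σ : Equiv.Perm (Fin s), Ideal.map (permMap K s b σ) J = J)

/-- `f` is a minimal monomial generator of the monomial ideal `J`: it is a monomial
belonging to `J` such that no proper monomial divisor of it lies in `J`. -/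
def IsMinMonGen (K : Type*) [Field K] (s b : ℕ)
    (J : Ideal (MvPolynomial (Fin s × Fin b) K)) (f : MvPolynomial (Fin s × Fin b) K) : Prop :=
  (∃ m : (Fin s × Fin b) →₀ ℕ, f = monomial m 1) ∧ f ∈ J ∧
    ∀ g : MvPolynomial (Fin s × Fin b) K,
      (∃ m : (Fin s × Fin b) →₀ ℕ, g = monomial m 1) → g ∣ f → g ≠ f → g ∉ J

/-- A monomial ideal has linear quotients: its minimal monomial generators can be ordered
`u_0, …, u_{r-1}` so that each colon ideal `(⟨u_0, …, u_{i-1}⟩ : u_i)` (`i ≥ 1`) is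
generated by a subset of the variables. -/
def HasLinearQuotients (K : Type*) [Field K] (s b : ℕ)
    (J : Ideal (MvPolynomial (Fin s × Fin b) K)) : Prop :=
  ∃ (r : ℕ) (u : Fin r → MvPolynomial (Fin s × Fin b) K),
    Function.Injective u ∧
    (∀ i, IsMinMonGen K s b J (u i)) ∧
    (∀ f, IsMinMonGen K s b J f → ∃ i, u i = f) ∧
    ∀ i : Fin r, 0 < (i : ℕ) →
      ∃ V : Set (Fin s × Fin b),
        Submodule.colon (Ideal.span {g | ∃ j : Fin r, j < i ∧ g = u j})
          (Ideal.span {u i}) = Ideal.span (X '' V)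

/-- `ν` arises from `μ` by setting some entries to zero. -/
def IsRestriction {s : ℕ} (ν μ : Fin s → ℕ) : Prop :=
  ∀ i, ν i = 0 ∨ ν i = μ i

/-- The combinatorial shadow of a sparse symmetric shifted ideal: a family of tuples closed under
filling in zeros, under `leZero` and under permutations. -/
structure IsSymmShiftedFamily {s : ℕ} (b : ℕ) (A : Set (Fin s → ℕ)) : Prop where
  bounded : ∀ μ ∈ A, ∀ i, μ i ≤ b
  fill : ∀ ν ∈ A, ∀ μ, IsRestriction ν μ → (∀ i, μ i ≤ b) → μ ∈ A
  shift : ∀ μ ∈ A, ∀ μ', leZero μ' μ → μ' ∈ A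
  perm : ∀ μ ∈ A, ∀ σ : Equiv.Perm (Fin s), μ ∘ σ ∈ A

/-- `μ` belongs to `A`, but deleting any nonzero entry of `μ` leaves `A`. -/
def IsMinTuple {s : ℕ} (A : Set (Fin s → ℕ)) (μ : Fin s → ℕ) : Prop :=
  μ ∈ A ∧ ∀ i, 0 < μ i → Function.update μ i 0 ∉ A

/-- The weight of the variable in position `i` with index `j`; `j = 0` means no variable. -/
def entryWeight {s : ℕ} (i : Fin s) (j : ℕ) : ℕ :=
  if j = 0 then 0 else s * j + i

/-- The total weight of a tuple, by which the generators are ordered. -/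
def tupleWeight {s : ℕ} (μ : Fin s → ℕ) : ℕ :=
  ∑ i, entryWeight i (μ i)

section Combinatorics

variable {s b : ℕ} {A : Set (Fin s → ℕ)}

theorem entryWeight_zero (i : Fin s) : entryWeight i 0 = 0 := by
  simp [entryWeight]

theorem entryWeight_strictMono (i : Fin s) : StrictMono (entryWeight i) := by
  intro a c h
  have hs : 0 < s := i.pos
  have h1 := Nat.mul_lt_mul_of_pos_left h hs
  unfold entryWeight
  split_ifs <;> omega

theorem entryWeight_pos (i : Fin s) {j : ℕ} (hj : j ≠ 0) : 0 < entryWeight i j := by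
  simpa [entryWeight_zero] using entryWeight_strictMono i (Nat.pos_of_ne_zero hj)

theorem le_of_entryWeight_le {i k : Fin s} {a c : ℕ} (hc : c ≠ 0)
    (h : entryWeight i a ≤ entryWeight k c) : a ≤ c := by
  by_contra! hlt
  have h1 : s * (c + 1) ≤ s * a := Nat.mul_le_mul_left s hlt
  have := i.isLt
  have := k.isLt
  rw [mul_add] at h1
  simp only [entryWeight, hc, if_false, show a ≠ 0 by omega] at h
  omega

theorem entryWeight_ne {i k : Fin s} {a c : ℕ} (ha : a ≠ 0) (hc : c ≠ 0) (hik : i ≠ k) :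
    entryWeight i a ≠ entryWeight k c := by
  intro h
  obtain rfl : a = c :=
    le_antisymm (le_of_entryWeight_le hc h.le) (le_of_entryWeight_le ha h.ge)
  simp only [entryWeight, hc, if_false] at h
  exact hik (Fin.ext (by omega))

theorem tupleWeight_update (μ : Fin s → ℕ) (i : Fin s) (c : ℕ) :
    tupleWeight (Function.update μ i c) + entryWeight i (μ i) =
      tupleWeight μ + entryWeight i c := by
  unfold tupleWeight
  rw [← Finset.add_sum_erase _ _ (Finset.mem_univ i),
    ← Finset.add_sum_erase _ (fun k => entryWeight k (μ k)) (Finset.mem_univ i)]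
  have : ∑ k ∈ Finset.univ.erase i, entryWeight k (Function.update μ i c k) =
      ∑ k ∈ Finset.univ.erase i, entryWeight k (μ k) :=
    Finset.sum_congr rfl fun k hk => by
      rw [Function.update_of_ne (Finset.ne_of_mem_erase hk)]
  simp only [this, Function.update_self]
  omega

theorem IsRestriction.tupleWeight_le {ν μ : Fin s → ℕ} (h : IsRestriction ν μ) :
    tupleWeight ν ≤ tupleWeight μ :=
  Finset.sum_le_sum fun i _ => (entryWeight_strictMono i).monotone <| by
    rcases h i with h | h <;> omega

theorem IsMinTuple.eq_of_isRestriction (hA : IsSymmShiftedFamily b A) {ν μ : Fin s → ℕ}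
    (hμ : IsMinTuple A μ) (hν : ν ∈ A) (h : IsRestriction ν μ) : ν = μ := by
  by_contra hne
  obtain ⟨i, hi⟩ := Function.ne_iff.mp hne
  have hνi : ν i = 0 := (h i).resolve_right hi
  refine hμ.2 i (by omega) (hA.fill ν hν _ (fun k => ?_) fun k => ?_)
  · rcases eq_or_ne k i with rfl | hk
    · exact Or.inl hνi
    · simpa [hk] using h k
  · rcases eq_or_ne k i with rfl | hk
    · simp
    · simpa [hk] using hA.bounded μ hμ.1 k

theorem exists_isMinTuple {μ : Fin s → ℕ} (hμ : μ ∈ A) :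
    ∃ ν, IsMinTuple A ν ∧ IsRestriction ν μ := by
  induction hn : tupleWeight μ using Nat.strong_induction_on generalizing μ with
  | _ n ih =>
    by_cases hmin : IsMinTuple A μ
    · exact ⟨μ, hmin, fun _ => Or.inr rfl⟩
    · simp only [IsMinTuple, hμ, true_and] at hmin
      push Not at hmin
      obtain ⟨i, hi, hmem⟩ := hmin
      have hw := tupleWeight_update μ i 0
      have hpos := entryWeight_pos i hi.ne'
      rw [entryWeight_zero] at hw
      obtain ⟨ν, hν, hr⟩ := ih _ (by omega) hmem rfl
      refine ⟨ν, hν, fun k => ?_⟩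
      rcases eq_or_ne k i with rfl | hk
      · have := hr k
        simp only [Function.update_self, or_self] at this
        exact Or.inl this
      · simpa [hk] using hr k

/-- If `v'` has smaller weight than the minimal tuple `v` and differs from a restriction of `v` only
at `i`, then a minimal restriction of `v'` keeps the entry at `i`. -/
theorem exists_isMinTuple_of_lt (hA : IsSymmShiftedFamily b A) {v v' : Fin s → ℕ}
    (hv : IsMinTuple A v) (hv' : v' ∈ A) (hlt : tupleWeight v' < tupleWeight v) {i : Fin s}
    (h : ∀ k, k ≠ i → v' k = 0 ∨ v' k = v k) :
    ∃ w, IsMinTuple A w ∧ tupleWeight w < tupleWeight v ∧ w i = v' i ∧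
      ∀ k, k ≠ i → w k = 0 ∨ w k = v k := by
  obtain ⟨w, hw, hr⟩ := exists_isMinTuple hv'
  have hwv : ∀ k, k ≠ i → w k = 0 ∨ w k = v k := fun k hk => by
    rcases hr k with h1 | h1
    · exact Or.inl h1
    · exact h1 ▸ h k hk
  have hwlt : tupleWeight w < tupleWeight v := hr.tupleWeight_le.trans_lt hlt
  refine ⟨w, hw, hwlt, (hr i).resolve_left fun h0 => ?_, hwv⟩
  have : w = v := hv.eq_of_isRestriction hA hw.1 fun k => by
    rcases eq_or_ne k i with rfl | hk
    · exact Or.inl h0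
    · exact hwv k hk
  exact hwlt.ne (congrArg _ this)

theorem tupleWeight_lt_of_card_le {u v : Fin s → ℕ} (hne : u ≠ v)
    (hcommon : ∀ i, u i ≠ 0 → v i ≤ u i)
    (hcross : ∀ i k, u i ≠ 0 → v i = 0 → u k = 0 → v k ≠ 0 →
      entryWeight k (v k) < entryWeight i (u i))
    (hcard : (Finset.univ.filter fun k => u k = 0 ∧ v k ≠ 0).card ≤
      (Finset.univ.filter fun i => u i ≠ 0 ∧ v i = 0).card) :
    tupleWeight v < tupleWeight u := by
  set I := Finset.univ.filter fun i => u i ≠ 0 ∧ v i = 0 with hI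
  set K := Finset.univ.filter fun k => u k = 0 ∧ v k ≠ 0 with hK
  have hdisj : Disjoint I K := Finset.disjoint_left.mpr fun i hi hk => by
    simp only [hI, hK, Finset.mem_filter] at hi hk
    exact hi.2.1 hk.2.1
  have hu : ∑ k ∈ K, entryWeight k (u k) = 0 := Finset.sum_eq_zero fun k hk => by
    rw [(Finset.mem_filter.mp hk).2.1, entryWeight_zero]
  have hv : ∑ i ∈ I, entryWeight i (v i) = 0 := Finset.sum_eq_zero fun k hk => by
    rw [(Finset.mem_filter.mp hk).2.2, entryWeight_zero]
  have hcompl : ∀ i ∈ (I ∪ K)ᶜ, v i ≤ u i := fun i hi => by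
    simp only [hI, hK, Finset.mem_compl, Finset.mem_union, Finset.mem_filter, Finset.mem_univ,
      true_and] at hi
    have := hcommon i
    omega
  have hle : ∑ i ∈ (I ∪ K)ᶜ, entryWeight i (v i) ≤ ∑ i ∈ (I ∪ K)ᶜ, entryWeight i (u i) :=
    Finset.sum_le_sum fun i hi => (entryWeight_strictMono i).monotone (hcompl i hi)
  have hsplit : ∀ μ : Fin s → ℕ, tupleWeight μ = ∑ i ∈ I, entryWeight i (μ i) +
      ∑ k ∈ K, entryWeight k (μ k) + ∑ i ∈ (I ∪ K)ᶜ, entryWeight i (μ i) := fun μ => by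
    rw [← Finset.sum_union hdisj, Finset.sum_add_sum_compl, tupleWeight]
  rw [hsplit u, hsplit v, hu, hv]
  rcases I.eq_empty_or_nonempty with hempty | hnonempty
  · have hKempty : K = ∅ := by simpa [hempty] using hcard
    obtain ⟨i, hi⟩ := Function.ne_iff.mp hne
    have hlt : ∑ i ∈ (I ∪ K)ᶜ, entryWeight i (v i) < ∑ i ∈ (I ∪ K)ᶜ, entryWeight i (u i) := by
      have hmem : i ∈ (I ∪ K)ᶜ := by simp [hempty, hKempty]
      exact Finset.sum_lt_sum
        (fun i hi => (entryWeight_strictMono i).monotone (hcompl i hi))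
        ⟨i, hmem, entryWeight_strictMono i (lt_of_le_of_ne (hcompl i hmem) hi.symm)⟩
    simpa [hempty, hKempty] using hlt
  · obtain ⟨i₀, hi₀, hmin⟩ := I.exists_min_image (fun i => entryWeight i (u i)) hnonempty
    have hi₀' := (Finset.mem_filter.mp hi₀).2
    set M := entryWeight i₀ (u i₀) with hM
    have hMpos : 0 < M := entryWeight_pos i₀ hi₀'.1
    have hIge : I.card * M ≤ ∑ i ∈ I, entryWeight i (u i) := by
      simpa using Finset.card_nsmul_le_sum I _ M hmin
    have hKle : ∑ k ∈ K, entryWeight k (v k) ≤ K.card * (M - 1) := by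
      refine (Finset.sum_le_card_nsmul K _ (M - 1) fun k hk => ?_).trans_eq (by simp)
      have hk' := (Finset.mem_filter.mp hk).2
      exact Nat.le_sub_one_of_lt (hcross i₀ k hi₀'.1 hi₀'.2 hk'.1 hk'.2)
    have hKI : K.card * (M - 1) ≤ I.card * (M - 1) := Nat.mul_le_mul_right _ hcard
    have hI1 : I.card * (M - 1) < I.card * M :=
      Nat.mul_lt_mul_of_pos_left (by omega) hnonempty.card_pos
    omega

theorem IsMinTuple.card_le (hA : IsSymmShiftedFamily b A) {u v : Fin s → ℕ}
    (hu : u ∈ A) (hv : IsMinTuple A v)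
    (hcommon : ∀ i, u i ≠ 0 → v i ≤ u i)
    (hcross : ∀ i k, u i ≠ 0 → v i = 0 → u k = 0 → v k ≠ 0 → v k ≤ u i) :
    (Finset.univ.filter fun k => u k = 0 ∧ v k ≠ 0).card ≤
      (Finset.univ.filter fun i => u i ≠ 0 ∧ v i = 0).card := by
  set I := Finset.univ.filter fun i => u i ≠ 0 ∧ v i = 0 with hI
  set K := Finset.univ.filter fun k => u k = 0 ∧ v k ≠ 0 with hK
  by_contra! hlt
  have memI : ∀ i, i ∈ I ↔ u i ≠ 0 ∧ v i = 0 := fun i => by simp [hI]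
  have memK : ∀ i, i ∈ K ↔ u i = 0 ∧ v i ≠ 0 := fun i => by simp [hK]
  obtain ⟨e⟩ : Nonempty (I ↪ K) :=
    Function.Embedding.nonempty_of_card_le (by simpa using hlt.le)
  let f : Fin s → Fin s := fun i => if h : i ∈ I then e ⟨i, h⟩ else i
  have hfI : ∀ i (h : i ∈ I), f i = e ⟨i, h⟩ := fun i h => dif_pos h
  have hfK : ∀ i, i ∈ I → f i ∈ K := fun i h => hfI i h ▸ (e ⟨i, h⟩).2
  have hfn : ∀ i, i ∉ I → f i = i := fun i h => dif_neg h
  have hinj : Set.InjOn f (Finset.univ.filter fun i => u i ≠ 0 : Finset (Fin s)) := by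
    intro x hx y hy hxy
    simp only [Finset.coe_filter, Finset.mem_univ, true_and, Set.mem_ofPred_eq] at hx hy
    by_cases hxI : x ∈ I <;> by_cases hyI : y ∈ I
    · rw [hfI x hxI, hfI y hyI] at hxy
      simpa using e.injective (Subtype.ext hxy)
    · have := (memK _).mp (hfK x hxI)
      rw [hxy, hfn y hyI] at this
      exact absurd this.1 hy
    · have := (memK _).mp (hfK y hyI)
      rw [← hxy, hfn x hxI] at this
      exact absurd this.1 hx
    · rwa [hfn x hxI, hfn y hyI] at hxy
  obtain ⟨g, hg⟩ := Finset.exists_equiv_extend_of_card_eq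
    (t := (Finset.univ : Finset (Fin s))) (by simp) (Finset.subset_univ _) hinj
  let σ : Equiv.Perm (Fin s) := g.trans (Equiv.subtypeUnivEquiv fun _ => Finset.mem_univ _)
  have hσ : ∀ i, u i ≠ 0 → σ i = f i := fun i hi => hg i (by simpa using hi)
  let v' : Fin s → ℕ := fun k => if u (σ.symm k) = 0 then 0 else v k
  have hshift : leZero v' (u ∘ σ.symm) := by
    intro k
    obtain ⟨i, rfl⟩ := σ.surjective k
    by_cases hi : u i = 0
    · simp [v', hi]
    · simp only [v', Function.comp, Equiv.symm_apply_apply, hi, if_false, iff_false]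
      rw [hσ i hi]
      by_cases hiI : i ∈ I
      · have h1 := (memK _).mp (hfK i hiI)
        exact ⟨hcross i _ hi ((memI i).mp hiI).2 h1.1 h1.2, h1.2⟩
      · rw [hfn i hiI]
        exact ⟨hcommon i hi, fun h => hiI ((memI i).mpr ⟨hi, h⟩)⟩
  have hv' : v' = v := hv.eq_of_isRestriction hA
    (hA.shift _ (hA.perm u hu σ.symm) _ hshift) fun k => by
      simp only [v']
      split_ifs <;> simp
  have hsub : K ⊆ I.image σ := fun k hk => by
    obtain ⟨i, rfl⟩ := σ.surjective k
    have hk' := (memK _).mp hk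
    have hi : u i ≠ 0 := fun h => hk'.2 (by rw [← hv']; simp [v', h])
    refine Finset.mem_image_of_mem _ ?_
    by_contra hiI
    rw [hσ i hi, hfn i hiI] at hk'
    exact hi hk'.1
  exact absurd ((Finset.card_le_card hsub).trans Finset.card_image_le) (by omega)

/-- The exchange property behind linear quotients. -/
theorem IsMinTuple.exists_exchange (hA : IsSymmShiftedFamily b A) {u v : Fin s → ℕ}
    (hu : IsMinTuple A u) (hv : IsMinTuple A v) (hne : u ≠ v)
    (hle : tupleWeight u ≤ tupleWeight v) :
    ∃ w i, IsMinTuple A w ∧ tupleWeight w < tupleWeight v ∧ u i ≠ 0 ∧ u i ≠ v i ∧ w i = u i ∧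
      ∀ k, k ≠ i → w k = 0 ∨ w k = v k := by
  by_cases h1 : ∃ i, u i ≠ 0 ∧ u i < v i
  · obtain ⟨i, hi, hlt⟩ := h1
    have hmem : Function.update v i (u i) ∈ A := hA.shift v hv.1 _ fun k => by
      rcases eq_or_ne k i with rfl | hk
      · simp only [Function.update_self]
        omega
      · simp [hk]
    have hw := tupleWeight_update v i (u i)
    have := entryWeight_strictMono i hlt
    obtain ⟨w, hwmin, hwlt, hwi, hwk⟩ := exists_isMinTuple_of_lt hA hv hmem (by omega)
      (i := i) fun k hk => by simp [hk]
    exact ⟨w, i, hwmin, hwlt, hi, hlt.ne, by simpa using hwi, hwk⟩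
  by_cases h2 : ∃ i k, u i ≠ 0 ∧ v i = 0 ∧ u k = 0 ∧ v k ≠ 0 ∧
      entryWeight i (u i) ≤ entryWeight k (v k)
  · obtain ⟨i, k, hui, hvi, huk, hvk, hik⟩ := h2
    have hne' : i ≠ k := fun h => hui (h ▸ huk)
    have hlt := lt_of_le_of_ne hik (entryWeight_ne hui hvk hne')
    have hmem : Function.update (Function.update v k 0) i (u i) ∈ A := by
      refine hA.shift _ (hA.perm v hv.1 (Equiv.swap i k)) _ fun l => ?_
      rcases eq_or_ne l i with rfl | hli
      · simpa [hvk, hui] using le_of_entryWeight_le hvk hik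
      · rcases eq_or_ne l k with rfl | hlk
        · simp [hli, hvi]
        · simp [hli, hlk, Equiv.swap_apply_of_ne_of_ne]
    have hw := tupleWeight_update (Function.update v k 0) i (u i)
    have hw' := tupleWeight_update v k 0
    rw [Function.update_of_ne hne', hvi] at hw
    rw [entryWeight_zero] at hw hw'
    obtain ⟨w, hwmin, hwlt, hwi, hwk⟩ := exists_isMinTuple_of_lt hA hv hmem (by omega)
      (i := i) fun l hl => by
        rcases eq_or_ne l k with rfl | hlk <;> simp [*]
    exact ⟨w, i, hwmin, hwlt, hui, by omega, by simpa using hwi, hwk⟩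
  push Not at h1 h2
  refine absurd (tupleWeight_lt_of_card_le hne h1 h2 (hv.card_le hA hu.1 h1 ?_)) hle.not_gt
  exact fun i k hui hvi huk hvk => le_of_entryWeight_le hui (h2 i k hui hvi huk hvk).le

end Combinatorics

/-- The exponent vector of `z^μ`. -/
noncomputable def sparseExp {s : ℕ} (b : ℕ) (μ : Fin s → ℕ) : (Fin s × Fin b) →₀ ℕ :=
  Finsupp.equivFunOnFinite.symm fun p => if μ p.1 = (p.2 : ℕ) + 1 then 1 else 0

section Monomials

variable {K : Type*} [Field K] {s b : ℕ}

theorem sparseExp_apply (μ : Fin s → ℕ) (p : Fin s × Fin b) :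
    sparseExp b μ p = if μ p.1 = (p.2 : ℕ) + 1 then 1 else 0 := rfl

theorem sparseMon_eq_monomial (μ : Fin s → ℕ) :
    sparseMon K s b μ = monomial (sparseExp b μ) 1 := by
  rw [monomial_eq, Finsupp.prod_fintype _ _ (by simp), Fintype.prod_prod_type, C_1, one_mul]
  refine Finset.prod_congr rfl fun i _ => Finset.prod_congr rfl fun j _ => ?_
  rw [sparseExp_apply]
  split_ifs <;> simp

theorem sparseExp_le_iff {ν μ : Fin s → ℕ} (hν : ∀ i, ν i ≤ b) :
    sparseExp b ν ≤ sparseExp b μ ↔ IsRestriction ν μ := by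
  constructor
  · intro h i
    by_contra! hi
    obtain ⟨c, hc⟩ := Nat.exists_eq_succ_of_ne_zero hi.1
    have := hν i
    have := h (i, ⟨c, by omega⟩)
    simp only [sparseExp_apply] at this
    rw [if_pos (by simpa using hc), if_neg (by omega)] at this
    omega
  · intro h p
    simp only [sparseExp_apply]
    have := h p.1
    split_ifs <;> omega

theorem permMap_sparseMon (σ : Equiv.Perm (Fin s)) (μ : Fin s → ℕ) :
    permMap K s b σ (sparseMon K s b μ) = sparseMon K s b (μ ∘ σ.symm) := by
  simp only [sparseMon, map_prod]
  rw [← Equiv.prod_comp σ fun i => ∏ j : Fin b,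
    if (μ ∘ σ.symm) i = (j : ℕ) + 1 then (X (i, j) : MvPolynomial (Fin s × Fin b) K) else 1]
  refine Finset.prod_congr rfl fun i _ => Finset.prod_congr rfl fun j _ => ?_
  rw [apply_ite (permMap K s b σ)]
  simp [permMap]

theorem monomial_mem_span_monomial_iff {τ : Type*} {T : Set (τ →₀ ℕ)} {m : τ →₀ ℕ} :
    monomial m (1 : K) ∈ Ideal.span ((fun e => monomial e (1 : K)) '' T) ↔ ∃ e ∈ T, e ≤ m := by
  classical
  rw [mem_ideal_span_monomial_image, support_monomial, if_neg one_ne_zero]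
  simp

theorem isMinSparseGen_iff {J : Ideal (MvPolynomial (Fin s × Fin b) K)} {μ : Fin s → ℕ} :
    IsMinSparseGen K s b J μ ↔
      IsMinTuple {ν | (∀ i, ν i ≤ b) ∧ sparseMon K s b ν ∈ J} μ := by
  simp only [IsMinSparseGen, IsMinTuple, Set.mem_ofPred_eq, and_assoc]
  refine and_congr_right fun hb => and_congr_right fun _ => forall₂_congr fun i _ => ?_
  rw [not_and, imp_iff_right]
  intro k
  rcases eq_or_ne k i with rfl | hk
  · simp
  · simpa [hk] using hb k

theorem sparseMon_mem_of_isRestriction {J : Ideal (MvPolynomial (Fin s × Fin b) K)}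
    {ν μ : Fin s → ℕ} (hb : ∀ i, ν i ≤ b) (h : IsRestriction ν μ)
    (hν : sparseMon K s b ν ∈ J) : sparseMon K s b μ ∈ J := by
  refine J.mem_of_dvd ?_ hν
  rw [sparseMon_eq_monomial, sparseMon_eq_monomial, monomial_dvd_monomial]
  exact ⟨Or.inr ((sparseExp_le_iff hb).mpr h), dvd_rfl⟩

theorem IsSSS.isSymmShiftedFamily {J : Ideal (MvPolynomial (Fin s × Fin b) K)}
    (hJ : IsSSS K s b J) :
    IsSymmShiftedFamily b {ν | (∀ i, ν i ≤ b) ∧ sparseMon K s b ν ∈ J} where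
  bounded μ hμ := hμ.1
  fill ν hν μ hr hb := ⟨hb, sparseMon_mem_of_isRestriction hν.1 hr hν.2⟩
  shift μ hμ μ' hμ' := by
    have hb : ∀ i, μ' i ≤ b := fun i => (hμ' i).1.trans (hμ.1 i)
    obtain ⟨ν, hν, hr⟩ := exists_isMinTuple hμ
    refine ⟨hb, sparseMon_mem_of_isRestriction (ν := fun i => if ν i = 0 then 0 else μ' i)
      (fun i => ?_) (fun i => ?_)
      (hJ.2.2.1 ν (isMinSparseGen_iff.mpr hν) _ fun i => ?_)⟩
    · have := hb i
      split_ifs <;> omega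
    · dsimp only
      split_ifs <;> simp
    · have := hr i
      have := hμ' i
      split_ifs <;> omega
  perm μ hμ σ := by
    refine ⟨fun i => hμ.1 _, ?_⟩
    have := Ideal.mem_map_of_mem (permMap K s b σ.symm) hμ.2
    rwa [hJ.2.2.2, permMap_sparseMon] at this

theorem sparseMon_injOn {ν μ : Fin s → ℕ} (hν : ∀ i, ν i ≤ b) (hμ : ∀ i, μ i ≤ b)
    (h : sparseMon K s b ν = sparseMon K s b μ) : ν = μ := by
  rw [sparseMon_eq_monomial, sparseMon_eq_monomial] at h
  have he := monomial_left_injective (one_ne_zero (α := K)) h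
  have h1 := (sparseExp_le_iff hν).mp he.le
  have h2 := (sparseExp_le_iff hμ).mp he.ge
  funext i
  have := h1 i
  have := h2 i
  omega

theorem IsSSS.isMinMonGen_iff {J : Ideal (MvPolynomial (Fin s × Fin b) K)}
    (hJ : IsSSS K s b J) {f : MvPolynomial (Fin s × Fin b) K} :
    IsMinMonGen K s b J f ↔ ∃ μ,
      IsMinTuple {ν | (∀ i, ν i ≤ b) ∧ sparseMon K s b ν ∈ J} μ ∧ sparseMon K s b μ = f := by
  obtain ⟨S, hS, hspan⟩ := hJ.2.1
  have hmem : ∀ m, monomial m (1 : K) ∈ J → ∃ μ ∈ S, sparseExp b μ ≤ m := fun m hm => by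
    have himage : sparseMon K s b '' S = (fun e => monomial e (1 : K)) '' (sparseExp b '' S) := by
      rw [Set.image_image]
      exact Set.image_congr fun μ _ => sparseMon_eq_monomial μ
    rw [hspan, himage, monomial_mem_span_monomial_iff] at hm
    simpa using hm
  have hSJ : ∀ μ ∈ S, sparseMon K s b μ ∈ J := fun μ hμ =>
    hspan ▸ Ideal.subset_span (Set.mem_image_of_mem _ hμ)
  constructor
  · rintro ⟨⟨m, rfl⟩, hmJ, hmin⟩
    obtain ⟨μ, hμS, hle⟩ := hmem m hmJ
    have hμ : sparseMon K s b μ = monomial m 1 := by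
      by_contra hne
      refine hmin _ ⟨_, sparseMon_eq_monomial μ⟩ ?_ hne (hSJ μ hμS)
      rw [sparseMon_eq_monomial, monomial_dvd_monomial]
      exact ⟨Or.inr hle, dvd_rfl⟩
    refine ⟨μ, isMinSparseGen_iff.mp ⟨hS μ hμS, hSJ μ hμS, fun i hi => ?_⟩, hμ⟩
    have hb : ∀ k, Function.update μ i 0 k ≤ b := fun k => by
      rcases eq_or_ne k i with rfl | hk
      · simp
      · simpa [hk] using hS μ hμS k
    refine hmin _ ⟨_, sparseMon_eq_monomial _⟩ ?_ fun h => ?_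
    · rw [← hμ, sparseMon_eq_monomial, sparseMon_eq_monomial, monomial_dvd_monomial]
      refine ⟨Or.inr ((sparseExp_le_iff hb).mpr fun k => ?_), dvd_rfl⟩
      rcases eq_or_ne k i with rfl | hk <;> simp [*]
    · have := congrFun (sparseMon_injOn hb (hS μ hμS) (h.trans hμ.symm)) i
      simp only [Function.update_self] at this
      omega
  · rintro ⟨μ, hμ, rfl⟩
    refine ⟨⟨_, sparseMon_eq_monomial μ⟩, hμ.1.2, ?_⟩
    rintro _ ⟨m, rfl⟩ hdvd hne hmJ
    obtain ⟨ν, hνS, hle⟩ := hmem m hmJ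
    rw [sparseMon_eq_monomial, monomial_dvd_monomial] at hdvd
    have hmle := hdvd.1.resolve_left one_ne_zero
    obtain rfl : ν = μ := hμ.eq_of_isRestriction hJ.isSymmShiftedFamily
      ⟨hS ν hνS, hSJ ν hνS⟩ ((sparseExp_le_iff (hS ν hνS)).mp (hle.trans hmle))
    exact hne (by rw [sparseMon_eq_monomial, le_antisymm hle hmle])

/-- A colon of a monomial ideal by a monomial is generated by variables as soon as each generator
can be exchanged for one whose colon is a variable. -/
theorem exists_colon_eq_span_X {τ : Type*} {T : Set (τ →₀ ℕ)} {e : τ →₀ ℕ}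
    (h : ∀ d ∈ T, ∃ p, e p < d p ∧ ∃ d' ∈ T, d' ≤ e + Finsupp.single p 1) :
    ∃ V : Set τ, Submodule.colon (Ideal.span ((fun d => monomial d (1 : K)) '' T))
      (Ideal.span {monomial e (1 : K)}) = Ideal.span (X '' V) := by
  refine ⟨{p | ∃ d' ∈ T, d' ≤ e + Finsupp.single p 1}, le_antisymm (fun f hf => ?_) ?_⟩
  · have hfe := Submodule.mem_colon.mp hf _ (Ideal.mem_span_singleton_self _)
    rw [smul_eq_mul, mem_ideal_span_monomial_image] at hfe
    rw [mem_ideal_span_X_image]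
    intro m hm
    obtain ⟨d, hd, hle⟩ := hfe (m + e) (by
      rw [mem_support_iff, coeff_mul_monomial, mul_one]
      exact mem_support_iff.mp hm)
    obtain ⟨p, hp, hV⟩ := h d hd
    refine ⟨p, hV, fun h0 => ?_⟩
    have := hle p
    rw [Finsupp.add_apply] at this
    omega
  · rw [Ideal.span_le]
    rintro _ ⟨p, hp, rfl⟩
    refine Submodule.mem_colon.mpr fun g hg => ?_
    obtain ⟨q, rfl⟩ := Ideal.mem_span_singleton'.mp hg
    rw [smul_eq_mul, mul_left_comm]
    refine Ideal.mul_mem_left _ _ ?_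
    rw [X, monomial_mul, one_mul, add_comm, monomial_mem_span_monomial_iff]
    exact hp

theorem exists_sparseExp_lt_of_exchange {u v w : Fin s → ℕ} {i : Fin s} (hub : u i ≤ b)
    (hui : u i ≠ 0) (huv : u i ≠ v i) (hwi : w i = u i)
    (hwk : ∀ k, k ≠ i → w k = 0 ∨ w k = v k) :
    ∃ p, sparseExp b v p < sparseExp b u p ∧
      sparseExp b w ≤ sparseExp b v + Finsupp.single p 1 := by
  obtain ⟨c, hc⟩ := Nat.exists_eq_succ_of_ne_zero hui
  refine ⟨(i, ⟨c, by omega⟩), ?_, ?_⟩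
  · rw [sparseExp_apply, sparseExp_apply, if_neg (by dsimp only; omega),
      if_pos (by simpa using hc)]
    exact one_pos
  · rintro ⟨k, j⟩
    rw [Finsupp.add_apply, sparseExp_apply, sparseExp_apply]
    rcases eq_or_ne k i with rfl | hk
    · by_cases hj : w k = (j : ℕ) + 1
      · have : j = ⟨c, by omega⟩ := Fin.ext (by simp; omega)
        rw [this, Finsupp.single_eq_same]
        split_ifs <;> omega
      · simp [hj]
    · have := hwk k hk
      dsimp only
      split_ifs <;> omega

end Monomials

/-- Every finite set can be enumerated so that a given weight is monotone. -/
theorem Set.Finite.exists_monotone_enum {α : Type*} {S : Set α} (hS : S.Finite) (f : α → ℕ) :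
    ∃ (r : ℕ) (t : Fin r → α), Function.Injective t ∧ Set.range t = S ∧ Monotone (f ∘ t) := by
  have := hS.fintype
  let e := (Fintype.equivFin S).symm
  let g : Fin (Fintype.card S) → α := fun i => e i
  refine ⟨_, g ∘ Tuple.sort (f ∘ g),
    (Subtype.val_injective.comp e.injective).comp (Equiv.injective _), ?_, ?_⟩
  · rw [(Equiv.surjective _).range_comp]
    exact (e.surjective.range_comp _).trans Subtype.range_coe
  · exact Tuple.monotone_sort (f ∘ g)

/-- Every sparse symmetric shifted ideal `J` in the polynomial ring `Z`
has linear quotients. -/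
theorem sss_hasLinearQuotients {K : Type*} [Field K] (s b : ℕ)
    (J : Ideal (MvPolynomial (Fin s × Fin b) K)) (hJ : IsSSS K s b J) :
    HasLinearQuotients K s b J := by
  set A : Set (Fin s → ℕ) := {ν | (∀ i, ν i ≤ b) ∧ sparseMon K s b ν ∈ J} with hAdef
  have hA : IsSymmShiftedFamily b A := hJ.isSymmShiftedFamily
  have hfin : {μ | IsMinTuple A μ}.Finite :=
    (Set.finite_Iic fun _ : Fin s => b).subset fun μ hμ => hA.bounded μ hμ.1
  obtain ⟨r, t, htinj, htrange, htmono⟩ := hfin.exists_monotone_enum tupleWeight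
  have ht : ∀ i, IsMinTuple A (t i) := fun i => htrange.subset (Set.mem_range_self i)
  refine ⟨r, fun i => sparseMon K s b (t i), fun i j hij => htinj ?_,
    fun i => hJ.isMinMonGen_iff.mpr ⟨t i, ht i, rfl⟩, fun f hf => ?_, fun i _ => ?_⟩
  · exact sparseMon_injOn (hA.bounded _ (ht i).1) (hA.bounded _ (ht j).1) hij
  · obtain ⟨μ, hμ, rfl⟩ := hJ.isMinMonGen_iff.mp hf
    obtain ⟨i, rfl⟩ := htrange.superset hμ
    exact ⟨i, rfl⟩
  · have hset : {g | ∃ j : Fin r, j < i ∧ g = sparseMon K s b (t j)} =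
        (fun d => monomial d (1 : K)) '' ((fun j => sparseExp b (t j)) '' Set.Iio i) := by
      ext g
      simp [sparseMon_eq_monomial, eq_comm]
    rw [hset]
    dsimp only
    rw [sparseMon_eq_monomial]
    apply exists_colon_eq_span_X
    rintro _ ⟨j, hj, rfl⟩
    obtain ⟨w, k, hw, hwlt, huk, huv, hwk, hwl⟩ := (ht j).exists_exchange hA (ht i)
      (htinj.ne (ne_of_lt hj)) (htmono (le_of_lt hj))
    obtain ⟨p, hp, hle⟩ :=
      exists_sparseExp_lt_of_exchange (hA.bounded _ (ht j).1 k) huk huv hwk hwl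
    obtain ⟨l, rfl⟩ := htrange.superset hw
    exact ⟨p, hp, _, Set.mem_image_of_mem _ (lt_of_not_ge fun h => (htmono h).not_gt hwlt), hle⟩
end

section
/- Let λ = (λ_1 ≤ … ≤ λ_s) be a partition with entries in {0,…,b} and λ_s > 0. Set N_num = ⟨σ(z^λ) : σ ∈ S_s⟩ and N_denom = ⟨σ(z^λ z_{i,j}) : σ ∈ S_s, λ_i > 0, 1 ≤ j < λ_i⟩ + ⟨σ(z^λ z_{i,j}) : σ ∈ S_s, λ_i = 0, 1 ≤ j < λ_s⟩. Let g be a squarefree monomial in N_num. For each i ∈ {1,…,s} let μ_i = min{j : z_{i,j} divides g} if some z_{i,j} divides g and μ_i = 0 otherwise, let λ' = (λ'_1 ≤ … ≤ λ'_s) be the nondecreasing rearrangement of (μ_1,…,μ_s), and set θ = suppdeg(λ), θ' = suppdeg(λ'). Then g ∉ N_denom if and only if θ ≤ θ' and λ_{s−θ+k} = λ'_{s−θ'+k} for every k = 1,2,…,θ. -/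
open MvPolynomial

/-- The support degree: number of nonzero entries. -/
def suppdeg {s : ℕ} (ν : Fin s → ℕ) : ℕ := (Finset.univ.filter fun i => ν i ≠ 0).card

/-- The weight: sum of the entries. -/
def wt {s : ℕ} (ν : Fin s → ℕ) : ℕ := ∑ i, ν i

/-- The associated partition: the nondecreasing rearrangement of the tuple. -/
noncomputable def partOf {s : ℕ} (ν : Fin s → ℕ) : Fin s → ℕ := ν ∘ Tuple.sort ν

/-- The set of variables dividing the sparse monomial of `μ`. -/
def sparseVars (s b : ℕ) (μ : Fin s → ℕ) : Finset (Fin s × Fin b) :=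
  Finset.univ.filter fun p => μ p.1 = (p.2 : ℕ) + 1

/-- The permutation of the variables underlying `permMap`. -/
def permVars (s b : ℕ) (σ : Equiv.Perm (Fin s)) : Equiv.Perm (Fin s × Fin b) :=
  σ.prodCongr (Equiv.refl _)

lemma prod_X_eq_monomial {K ι : Type*} [Field K] (A : Finset ι) :
    (∏ p ∈ A, X p : MvPolynomial ι K) = monomial (∑ p ∈ A, Finsupp.single p 1) 1 := by
  classical
  induction A using Finset.induction_on with
  | empty => simp
  | insert a A ha ih => rw [Finset.prod_insert ha, Finset.sum_insert ha, ih, X, monomial_mul,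
      mul_one]

lemma sum_single_apply {ι : Type*} [DecidableEq ι] (A : Finset ι) (q : ι) :
    (∑ p ∈ A, Finsupp.single p 1 : ι →₀ ℕ) q = if q ∈ A then 1 else 0 := by
  simp [Finsupp.finsetSum_apply, Finsupp.single_apply]

lemma sum_single_le_iff {ι : Type*} (A G : Finset ι) :
    (∑ p ∈ A, Finsupp.single p 1 : ι →₀ ℕ) ≤ ∑ p ∈ G, Finsupp.single p 1 ↔ A ⊆ G := by
  classical
  rw [Finsupp.le_def]
  simp only [sum_single_apply]
  constructor
  · intro h q hq
    have := h q
    by_contra hG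
    simp [hq, hG] at this
  · intro h q
    by_cases hq : q ∈ A
    · simp [hq, h hq]
    · simp [hq]

lemma prod_X_mem_span_iff {K ι : Type*} [Field K] (S : Set (Finset ι)) (G : Finset ι) :
    (∏ p ∈ G, X p : MvPolynomial ι K) ∈
      Ideal.span ((fun A : Finset ι => (∏ p ∈ A, X p : MvPolynomial ι K)) '' S) ↔
      ∃ A ∈ S, A ⊆ G := by
  classical
  have h : (fun A : Finset ι => (∏ p ∈ A, X p : MvPolynomial ι K)) '' S =
      (fun d : ι →₀ ℕ => monomial d (1 : K)) ''
        ((fun A : Finset ι => ∑ p ∈ A, Finsupp.single p 1) '' S) := by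
    rw [Set.image_image]
    exact Set.image_congr fun A _ => prod_X_eq_monomial A
  rw [h, prod_X_eq_monomial, mem_ideal_span_monomial_image]
  simp [support_monomial, sum_single_le_iff]

lemma sparseMon_eq_prod (K : Type*) [Field K] (s b : ℕ) (μ : Fin s → ℕ) :
    sparseMon K s b μ = ∏ p ∈ sparseVars s b μ, X p := by
  rw [sparseMon, sparseVars, Finset.prod_filter, Fintype.prod_prod_type]

lemma permMap_prod_X (K : Type*) [Field K] (s b : ℕ) (σ : Equiv.Perm (Fin s))
    (A : Finset (Fin s × Fin b)) :
    permMap K s b σ (∏ p ∈ A, X p) = ∏ p ∈ A.map (permVars s b σ).toEmbedding, X p := by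
  simp [permMap, permVars, Prod.map]

lemma permMap_sparseMon_mul_X (K : Type*) [Field K] (s b : ℕ) (σ : Equiv.Perm (Fin s))
    (lam : Fin s → ℕ) (i : Fin s) (j : Fin b) (h : lam i ≠ (j : ℕ) + 1) :
    permMap K s b σ (sparseMon K s b lam * X (i, j)) =
      ∏ p ∈ (insert (i, j) (sparseVars s b lam)).map (permVars s b σ).toEmbedding, X p := by
  rw [← permMap_prod_X, Finset.prod_insert (by simpa [sparseVars] using h), sparseMon_eq_prod,
    mul_comm]

lemma map_sparseVars_subset_iff {s b : ℕ} (σ : Equiv.Perm (Fin s)) (lam : Fin s → ℕ)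
    (G : Finset (Fin s × Fin b)) :
    (sparseVars s b lam).map (permVars s b σ).toEmbedding ⊆ G ↔
      ∀ (i : Fin s) (j : Fin b), lam i = (j : ℕ) + 1 → (σ i, j) ∈ G := by
  rw [Finset.map_subset_iff_subset_preimage]
  simp [Finset.subset_iff, sparseVars, permVars]

lemma map_insert_sparseVars_subset_iff {s b : ℕ} (σ : Equiv.Perm (Fin s)) (lam : Fin s → ℕ)
    (i : Fin s) (j : Fin b) (G : Finset (Fin s × Fin b)) :
    (insert (i, j) (sparseVars s b lam)).map (permVars s b σ).toEmbedding ⊆ G ↔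
      (σ i, j) ∈ G ∧ ∀ (i : Fin s) (j : Fin b), lam i = (j : ℕ) + 1 → (σ i, j) ∈ G := by
  rw [Finset.map_insert, Finset.insert_subset_iff, map_sparseVars_subset_iff]
  simp [permVars]

lemma prod_X_mem_span_permMap_sparseMon_iff {K : Type*} [Field K] {s b : ℕ} (lam : Fin s → ℕ)
    (G : Finset (Fin s × Fin b)) :
    (∏ p ∈ G, X p : MvPolynomial (Fin s × Fin b) K) ∈
      Ideal.span {g | ∃ σ : Equiv.Perm (Fin s), g = permMap K s b σ (sparseMon K s b lam)} ↔
      ∃ σ : Equiv.Perm (Fin s),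
        ∀ (i : Fin s) (j : Fin b), lam i = (j : ℕ) + 1 → (σ i, j) ∈ G := by
  have h : {g | ∃ σ : Equiv.Perm (Fin s), g = permMap K s b σ (sparseMon K s b lam)} =
      (fun A : Finset (Fin s × Fin b) => (∏ p ∈ A, X p : MvPolynomial (Fin s × Fin b) K)) ''
        Set.range fun σ : Equiv.Perm (Fin s) =>
          (sparseVars s b lam).map (permVars s b σ).toEmbedding := by
    ext g
    simp only [sparseMon_eq_prod, permMap_prod_X, Set.mem_ofPred_eq, Set.mem_image,
      Set.exists_range_iff, eq_comm (a := g)]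
  rw [h, prod_X_mem_span_iff]
  simp only [Set.exists_range_iff, map_sparseVars_subset_iff]

lemma prod_X_mem_span_permMap_sparseMon_mul_X_iff {K : Type*} [Field K] {s b : ℕ}
    (lam : Fin s → ℕ) (G : Finset (Fin s × Fin b)) (P : Fin s → Fin b → Prop)
    (hP : ∀ i j, P i j → lam i ≠ (j : ℕ) + 1) :
    (∏ p ∈ G, X p : MvPolynomial (Fin s × Fin b) K) ∈
      Ideal.span {g | ∃ (σ : Equiv.Perm (Fin s)) (i : Fin s) (j : Fin b),
        P i j ∧ g = permMap K s b σ (sparseMon K s b lam * X (i, j))} ↔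
      ∃ (σ : Equiv.Perm (Fin s)) (i : Fin s) (j : Fin b), P i j ∧ (σ i, j) ∈ G ∧
        ∀ (i : Fin s) (j : Fin b), lam i = (j : ℕ) + 1 → (σ i, j) ∈ G := by
  have h : {g | ∃ (σ : Equiv.Perm (Fin s)) (i : Fin s) (j : Fin b),
        P i j ∧ g = permMap K s b σ (sparseMon K s b lam * X (i, j))} =
      (fun A : Finset (Fin s × Fin b) => (∏ p ∈ A, X p : MvPolynomial (Fin s × Fin b) K)) ''
        {A | ∃ (σ : Equiv.Perm (Fin s)) (i : Fin s) (j : Fin b), P i j ∧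
          A = (insert (i, j) (sparseVars s b lam)).map (permVars s b σ).toEmbedding} := by
    ext g
    constructor
    · rintro ⟨σ, i, j, hij, rfl⟩
      exact ⟨_, ⟨σ, i, j, hij, rfl⟩, (permMap_sparseMon_mul_X K s b σ lam i j (hP i j hij)).symm⟩
    · rintro ⟨_, ⟨σ, i, j, hij, rfl⟩, rfl⟩
      exact ⟨σ, i, j, hij, (permMap_sparseMon_mul_X K s b σ lam i j (hP i j hij)).symm⟩
  rw [h, prod_X_mem_span_iff]
  constructor
  · rintro ⟨_, ⟨σ, i, j, hij, rfl⟩, hA⟩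
    exact ⟨σ, i, j, hij, (map_insert_sparseVars_subset_iff σ lam i j G).1 hA⟩
  · rintro ⟨σ, i, j, hij, hA⟩
    exact ⟨_, ⟨σ, i, j, hij, rfl⟩, (map_insert_sparseVars_subset_iff σ lam i j G).2 hA⟩

/-- The number of nonzero entries of `ν` that are at most `t`. -/
def posCount {s : ℕ} (ν : Fin s → ℕ) (t : ℕ) : ℕ :=
  (Finset.univ.filter fun i => 0 < ν i ∧ ν i ≤ t).card

lemma card_filter_comp_perm {s : ℕ} (σ : Equiv.Perm (Fin s)) (P : Fin s → Prop)
    [DecidablePred P] :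
    (Finset.univ.filter fun i => P (σ i)).card = (Finset.univ.filter P).card :=
  Finset.card_equiv σ (by simp)

lemma posCount_partOf {s : ℕ} (ν : Fin s → ℕ) (t : ℕ) :
    posCount (partOf ν) t = posCount ν t :=
  card_filter_comp_perm (Tuple.sort ν) fun i => 0 < ν i ∧ ν i ≤ t

lemma suppdeg_le {s : ℕ} (ν : Fin s → ℕ) : suppdeg ν ≤ s :=
  (Finset.card_le_univ _).trans_eq (Fintype.card_fin s)

lemma posCount_le_suppdeg {s : ℕ} (ν : Fin s → ℕ) (t : ℕ) : posCount ν t ≤ suppdeg ν :=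
  Finset.card_le_card fun i hi => by
    simp only [Finset.mem_filter, Finset.mem_univ, true_and] at hi ⊢
    exact hi.1.ne'

lemma posCount_eq_suppdeg {s : ℕ} {ν : Fin s → ℕ} {t : ℕ} (h : ∀ i, ν i ≤ t) :
    posCount ν t = suppdeg ν := by
  simp [posCount, suppdeg, h, Nat.pos_iff_ne_zero]

lemma posCount_lt_suppdeg {s : ℕ} {ν : Fin s → ℕ} {t : ℕ} {i : Fin s} (h : t < ν i) :
    posCount ν t < suppdeg ν := by
  refine Finset.card_lt_card ⟨fun j hj => ?_, fun hsub => ?_⟩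
  · simp only [Finset.mem_filter, Finset.mem_univ, true_and] at hj ⊢
    exact hj.1.ne'
  · have := @hsub i (by simp; omega)
    simp at this
    omega

lemma card_le_eq {s : ℕ} (ν : Fin s → ℕ) (t : ℕ) :
    (Finset.univ.filter fun i => ν i ≤ t).card = s - suppdeg ν + posCount ν t := by
  have h₁ : (Finset.univ.filter fun i => ν i ≤ t).card =
      (Finset.univ.filter fun i => ν i = 0).card + posCount ν t := by
    rw [posCount, ← Finset.card_union_of_disjoint]
    · congr 1
      ext i
      simp
      omega
    · rw [Finset.disjoint_filter]
      omega
  have h₂ := Finset.card_filter_add_card_filter_not (s := (Finset.univ : Finset (Fin s)))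
    (fun i => ν i = 0)
  rw [Finset.card_univ, Fintype.card_fin] at h₂
  change _ + suppdeg ν = s at h₂
  omega

lemma Monotone.apply_le_iff_le_posCount {s : ℕ} {ν : Fin s → ℕ} (hν : Monotone ν) {k : ℕ}
    (hk : 1 ≤ k) {q : Fin s} (hq : (q : ℕ) = s - suppdeg ν + k - 1) (t : ℕ) :
    ν q ≤ t ↔ k ≤ posCount ν t := by
  have h := Tuple.lt_card_le_iff_apply_le_of_monotone (f := ν) (a := t) (j := q) hν
  rw [← h, card_le_eq]
  omega

lemma posCount_eq_iff {s : ℕ} (lam μ : Fin s → ℕ) (hlam : Monotone lam) (hμ : Monotone μ)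
    (m : Fin s) (hm : ∀ i, lam i ≤ lam m) (hle : ∀ t, posCount lam t ≤ posCount μ t) :
    (∀ t < lam m, posCount μ t ≤ posCount lam t) ↔
      (suppdeg lam ≤ suppdeg μ ∧
        ∀ k : ℕ, 1 ≤ k → k ≤ suppdeg lam → ∀ p q : Fin s,
          (p : ℕ) = s - suppdeg lam + k - 1 →
          (q : ℕ) = s - suppdeg μ + k - 1 → lam p = μ q) := by
  constructor
  · refine fun h => ⟨?_, fun k hk hk' p q hp hq => ?_⟩
    · rw [← posCount_eq_suppdeg hm]
      exact (hle _).trans (posCount_le_suppdeg _ _)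
    · refine eq_of_forall_ge_iff fun t => ?_
      rw [hlam.apply_le_iff_le_posCount hk hp, hμ.apply_le_iff_le_posCount hk hq]
      rcases lt_or_ge t (lam m) with ht | ht
      · rw [le_antisymm (h t ht) (hle t)]
      · have h₁ := posCount_eq_suppdeg fun i => (hm i).trans ht
        have h₂ := hle t
        omega
  · rintro ⟨hd, h⟩ t ht
    have hlt := posCount_lt_suppdeg ht
    have h₁ := suppdeg_le lam
    have h₂ := suppdeg_le μ
    have hk : 1 ≤ posCount lam t + 1 := by omega
    let p : Fin s := ⟨s - suppdeg lam + (posCount lam t + 1) - 1, by omega⟩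
    let q : Fin s := ⟨s - suppdeg μ + (posCount lam t + 1) - 1, by omega⟩
    have hpq := h _ hk hlt p q rfl rfl
    have hp := hlam.apply_le_iff_le_posCount hk (q := p) rfl t
    have hq := hμ.apply_le_iff_le_posCount hk (q := q) rfl t
    rw [hpq] at hp
    have := hp.symm.trans hq
    omega

lemma posCount_mono_of_perm {s : ℕ} {lam μ : Fin s → ℕ} (σ : Equiv.Perm (Fin s))
    (h : ∀ i, 0 < lam i → 0 < μ (σ i) ∧ μ (σ i) ≤ lam i) (t : ℕ) :
    posCount lam t ≤ posCount μ t := by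
  rw [posCount, posCount, ← card_filter_comp_perm σ fun i => 0 < μ i ∧ μ i ≤ t]
  refine Finset.card_le_card fun i hi => ?_
  simp only [Finset.mem_filter, Finset.mem_univ, true_and] at hi ⊢
  exact ⟨(h i hi.1).1, (h i hi.1).2.trans hi.2⟩

lemma posCount_le_iff_of_perm {s : ℕ} {lam μ : Fin s → ℕ} (σ : Equiv.Perm (Fin s))
    (h : ∀ i, 0 < lam i → 0 < μ (σ i) ∧ μ (σ i) ≤ lam i) (t : ℕ) :
    posCount μ t ≤ posCount lam t ↔
      ∀ i, 0 < μ (σ i) → μ (σ i) ≤ t → 0 < lam i ∧ lam i ≤ t := by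
  have hsub : (Finset.univ.filter fun i => 0 < lam i ∧ lam i ≤ t) ⊆
      Finset.univ.filter fun i => 0 < μ (σ i) ∧ μ (σ i) ≤ t := fun i hi => by
    simp only [Finset.mem_filter, Finset.mem_univ, true_and] at hi ⊢
    exact ⟨(h i hi.1).1, (h i hi.1).2.trans hi.2⟩
  rw [posCount, posCount, ← card_filter_comp_perm σ fun i => 0 < μ i ∧ μ i ≤ t]
  constructor
  · intro hc i hi hit
    have := Finset.eq_of_subset_of_card_le hsub hc
    simpa using this.ge (by simp [hi, hit] : i ∈ _)
  · intro H
    refine Finset.card_le_card fun i hi => ?_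
    simp only [Finset.mem_filter, Finset.mem_univ, true_and] at hi ⊢
    exact H i hi.1 hi.2

/-- Characterization of the squarefree monomials `g` in `N_num` that do not
lie in `N_denom`, in terms of the partition `λ` and the partition `λ'` associated to the
tuple `μ` of least indices of variables of `g`. -/
theorem mem_Nnum_not_mem_Ndenom_iff {K : Type*} [Field K] (s b : ℕ) (hs : 0 < s)
    (lam : Fin s → ℕ) (hmono : Monotone lam) (hlb : ∀ i, lam i ≤ b)
    (hpos : 0 < lam ⟨s - 1, by omega⟩)
    (G : Finset (Fin s × Fin b))
    (hg : (∏ p ∈ G, X p : MvPolynomial (Fin s × Fin b) K) ∈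
      Ideal.span {g | ∃ σ : Equiv.Perm (Fin s), g = permMap K s b σ (sparseMon K s b lam)})
    (μ : Fin s → ℕ)
    (hμ : ∀ i : Fin s,
      (μ i = 0 ∧ ∀ j : Fin b, (i, j) ∉ G) ∨
      (∃ j : Fin b, (i, j) ∈ G ∧ μ i = (j : ℕ) + 1 ∧
        ∀ j' : Fin b, (i, j') ∈ G → (j : ℕ) ≤ (j' : ℕ))) :
    (∏ p ∈ G, X p : MvPolynomial (Fin s × Fin b) K) ∉
        (Ideal.span {g | ∃ (σ : Equiv.Perm (Fin s)) (i : Fin s) (j : Fin b),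
            0 < lam i ∧ (j : ℕ) + 1 < lam i ∧
            g = permMap K s b σ (sparseMon K s b lam * X (i, j))} +
          Ideal.span {g | ∃ (σ : Equiv.Perm (Fin s)) (i : Fin s) (j : Fin b),
            lam i = 0 ∧ (j : ℕ) + 1 < lam ⟨s - 1, by omega⟩ ∧
            g = permMap K s b σ (sparseMon K s b lam * X (i, j))}) ↔
      (suppdeg lam ≤ suppdeg (partOf μ) ∧
        ∀ k : ℕ, 1 ≤ k → k ≤ suppdeg lam → ∀ p q : Fin s,
          (p : ℕ) = s - suppdeg lam + k - 1 →
          (q : ℕ) = s - suppdeg (partOf μ) + k - 1 →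
          lam p = partOf μ q) := by
  classical
  set m : Fin s := ⟨s - 1, by omega⟩ with hm_def
  have hm : ∀ i, lam i ≤ lam m := fun i => hmono (Fin.le_def.2 (by simp [hm_def]; omega))
  have hμG : ∀ i j, (i, j) ∈ G → 0 < μ i ∧ μ i ≤ (j : ℕ) + 1 := by
    intro i j hij
    rcases hμ i with ⟨-, h⟩ | ⟨j', -, h, h'⟩
    · exact absurd hij (h j)
    · have := h' j hij
      omega
  have hGμ : ∀ i, 0 < μ i → ∃ j : Fin b, (i, j) ∈ G ∧ μ i = (j : ℕ) + 1 := by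
    intro i hi
    rcases hμ i with ⟨h, -⟩ | ⟨j, hj, h, -⟩
    · omega
    · exact ⟨j, hj, h⟩
  have hval : ∀ σ : Equiv.Perm (Fin s),
      (∀ (i : Fin s) (j : Fin b), lam i = (j : ℕ) + 1 → (σ i, j) ∈ G) →
      ∀ i, 0 < lam i → 0 < μ (σ i) ∧ μ (σ i) ≤ lam i := by
    intro σ hσ i hi
    have hb := hlb i
    have h := hμG _ _ (hσ i ⟨lam i - 1, by omega⟩ (by simp; omega))
    exact ⟨h.1, h.2.trans (by simp; omega)⟩
  obtain ⟨σ, hσ⟩ := (prod_X_mem_span_permMap_sparseMon_iff lam G).1 hg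
  have hle : ∀ t, posCount lam t ≤ posCount (partOf μ) t := fun t => by
    rw [posCount_partOf]
    exact posCount_mono_of_perm σ (hval σ hσ) t
  rw [← posCount_eq_iff lam (partOf μ) hmono (Tuple.monotone_sort μ) m hm hle]
  simp only [posCount_partOf]
  rw [Submodule.add_eq_sup, ← Ideal.span_union]
  have hunion : {g | ∃ (σ : Equiv.Perm (Fin s)) (i : Fin s) (j : Fin b),
            0 < lam i ∧ (j : ℕ) + 1 < lam i ∧
            g = permMap K s b σ (sparseMon K s b lam * X (i, j))} ∪
          {g | ∃ (σ : Equiv.Perm (Fin s)) (i : Fin s) (j : Fin b),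
            lam i = 0 ∧ (j : ℕ) + 1 < lam m ∧
            g = permMap K s b σ (sparseMon K s b lam * X (i, j))} =
      {g | ∃ (σ : Equiv.Perm (Fin s)) (i : Fin s) (j : Fin b),
        ((j : ℕ) + 1 < lam i ∨ lam i = 0 ∧ (j : ℕ) + 1 < lam m) ∧
          g = permMap K s b σ (sparseMon K s b lam * X (i, j))} := by
    ext g
    constructor
    · rintro (⟨σ, i, j, -, h, rfl⟩ | ⟨σ, i, j, h, h', rfl⟩)
      · exact ⟨σ, i, j, Or.inl h, rfl⟩
      · exact ⟨σ, i, j, Or.inr ⟨h, h'⟩, rfl⟩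
    · rintro ⟨σ, i, j, h | ⟨h, h'⟩, rfl⟩
      · exact Or.inl ⟨σ, i, j, by omega, h, rfl⟩
      · exact Or.inr ⟨σ, i, j, h, h', rfl⟩
  rw [hunion, prod_X_mem_span_permMap_sparseMon_mul_X_iff lam G _ (by omega)]
  constructor
  · intro h t ht
    rw [posCount_le_iff_of_perm σ (hval σ hσ)]
    intro i hi hit
    obtain ⟨j, hj, hji⟩ := hGμ _ hi
    by_contra hcon
    exact h ⟨σ, i, j, by omega, hj, hσ⟩
  · rintro h ⟨τ, i, j, hij, hj, hτ⟩
    obtain ⟨h₁, h₂⟩ := hμG _ _ hj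
    have hlt : μ (τ i) < lam m := by
      have := hm i
      omega
    have := (posCount_le_iff_of_perm τ (hval τ hτ) _).1 (h _ hlt) i h₁ le_rfl
    omega
end

section
/- For every integer c with c_0 ≤ c ≤ h, one has (h−1)·(μ_a^0 + b(c−c_0)) ≥ c. -/
/-- With `h = bs - a + 1`, `c₀ = s - ⌊(a-1)/b⌋` and
`μₐ⁰ = a - b(s - c₀)`, for every `c` with `c₀ ≤ c ≤ h` one has
`(h - 1) · (μₐ⁰ + b(c - c₀)) ≥ c`. -/
theorem h_sub_one_mul_muHat_ge (s a b : ℕ) (hs : 1 ≤ s) (hb : 2 ≤ b)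
    (ha1 : (b - 1) * s + 1 < a) (ha2 : a < b * s)
    (h c₀ μ₀ : ℕ) (hh : h = b * s - a + 1) (hc₀ : c₀ = s - (a - 1) / b)
    (hμ₀ : μ₀ = a - b * (s - c₀))
    (c : ℕ) (hc1 : c₀ ≤ c) (hc2 : c ≤ h) :
    c ≤ (h - 1) * (μ₀ + b * (c - c₀)) := by
  have hdiv := Nat.div_add_mod (a - 1) b
  have hlt : (a - 1) % b < b := Nat.mod_lt _ (by omega)
  generalize (a - 1) / b = q at *
  have hqs : q < s := lt_of_mul_lt_mul_left (show b * q < b * s by omega) (Nat.zero_le b)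
  have hc₀q : s - c₀ = q := by omega
  rw [hc₀q] at hμ₀
  have hs_eq : s = q + c₀ := by omega
  have hbs : b * s = b * q + b * c₀ := by rw [hs_eq, Nat.mul_add]
  have hn : 1 ≤ h - 1 := by omega
  by_cases hμ : 2 ≤ μ₀ + b * (c - c₀)
  · calc c ≤ (h - 1) * 2 := by omega
      _ ≤ _ := Nat.mul_le_mul_left _ hμ
  · have hcc : c = c₀ := by
      by_contra hne
      have : b * 1 ≤ b * (c - c₀) := Nat.mul_le_mul_left b (by omega)
      omega
    have hμ_one : μ₀ = 1 := by omega
    have hbc : 2 * c₀ ≤ b * c₀ := Nat.mul_le_mul_right c₀ hb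
    rw [hcc, hμ_one, Nat.sub_self, Nat.mul_zero, Nat.add_zero, Nat.mul_one]
    omega
end

section
/- For all positive integers k, ℓ, m and every integer c with c_0 ≤ c ≤ h, one has (ℓ(h+m−1) − h + k)·μ̂_c − c(ℓ−1) ≥ ℓ·m·μ̂_c. -/
/-- With `h = bs - a + 1`, `c₀ = s - ⌊(a-1)/b⌋`,
`μₐ⁰ = a - b(s - c₀)` and `μ̂_c = μₐ⁰ + b(c - c₀)`, for all positive integers `k, ℓ, m`
and every `c` with `c₀ ≤ c ≤ h` one has
`(ℓ(h + m - 1) - h + k) · μ̂_c - c(ℓ - 1) ≥ ℓ · m · μ̂_c`. -/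
theorem symbolic_exponent_ineq (s a b : ℕ) (hs : 1 ≤ s) (hb : 2 ≤ b)
    (ha1 : (b - 1) * s + 1 < a) (ha2 : a < b * s)
    (h c₀ μ₀ : ℕ) (hh : h = b * s - a + 1) (hc₀ : c₀ = s - (a - 1) / b)
    (hμ₀ : μ₀ = a - b * (s - c₀))
    (k l m : ℕ) (hk : 0 < k) (hl : 0 < l) (hm : 0 < m)
    (c : ℕ) (hc1 : c₀ ≤ c) (hc2 : c ≤ h) :
    l * m * (μ₀ + b * (c - c₀)) ≤
      (l * (h + m - 1) - h + k) * (μ₀ + b * (c - c₀)) - c * (l - 1) := by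
  have hdiv : b * ((a - 1) / b) + (a - 1) % b = a - 1 := Nat.div_add_mod _ _
  have hlt : (a - 1) / b < s := by
    rw [Nat.div_lt_iff_lt_mul (by omega), mul_comm s b]
    omega
  generalize (a - 1) / b = q at *
  generalize (a - 1) % b = r at *
  have hsc : s - c₀ = q := by omega
  rw [hsc] at hμ₀
  have hμr : μ₀ = r + 1 := by omega
  have hs' : s = q + c₀ := by omega
  have hbs : b * s = b * q + b * c₀ := by rw [hs', mul_add]
  have hbc : 2 * c₀ ≤ b * c₀ := Nat.mul_le_mul_right _ hb
  have key : c ≤ (h - 1) * (μ₀ + b * (c - c₀)) := by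
    rcases Nat.lt_or_ge (μ₀ + b * (c - c₀)) 2 with hμ | hμ
    · have hb0 : b * (c - c₀) = 0 := by omega
      have hcc : c - c₀ = 0 := by
        rcases Nat.mul_eq_zero.mp hb0 with h0 | h0 <;> omega
      have hμ1 : μ₀ + b * (c - c₀) = 1 := by omega
      rw [hμ1, mul_one]
      omega
    · calc c ≤ (h - 1) * 2 := by omega
        _ ≤ _ := Nat.mul_le_mul_left _ hμ
  generalize μ₀ + b * (c - c₀) = M at key ⊢
  obtain ⟨n, rfl⟩ : ∃ n, h = n + 1 := ⟨h - 1, by omega⟩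
  obtain ⟨j, rfl⟩ : ∃ j, l = j + 1 := ⟨l - 1, by omega⟩
  obtain ⟨i, rfl⟩ : ∃ i, k = i + 1 := ⟨k - 1, by omega⟩
  obtain ⟨p, rfl⟩ : ∃ p, m = p + 1 := ⟨m - 1, by omega⟩
  have hcoef : (j + 1) * (n + 1 + (p + 1) - 1) - (n + 1) + (i + 1)
      = (j + 1) * (p + 1) + j * n + i := by
    have hexp : (j + 1) * (n + 1 + (p + 1) - 1)
        = (j + 1) * (p + 1) + j * n + n := by
      rw [show n + 1 + (p + 1) - 1 = n + p + 1 by omega]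
      ring
    have hpos : 1 ≤ (j + 1) * (p + 1) := Nat.mul_pos hl hm
    omega
  rw [hcoef]
  apply Nat.le_sub_of_add_le
  simp only [Nat.add_sub_cancel] at key ⊢
  nlinarith [Nat.mul_le_mul_left j key, Nat.zero_le (i * M)]
end

section
/- Let k, ℓ, m be positive integers and set m' = ℓ(h+m−1) − h + k. If λ_1 ≤ λ_2 ≤ … ≤ λ_s are nonnegative integers such that λ_1 + ⋯ + λ_c ≥ m'·μ̂_c for every integer c with c_0 ≤ c ≤ h, then ⌊λ_1/ℓ⌋ + ⋯ + ⌊λ_c/ℓ⌋ ≥ m·μ̂_c for every integer c with c_0 ≤ c ≤ h. -/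
/-- Flooring after division by `l` loses at most `l - 1` in each of the first `c` terms. -/
theorem sum_filter_val_lt_le_mul_sum_div {s l : ℕ} (f : Fin s → ℕ) (hl : 0 < l) (c : ℕ) :
    ∑ j ∈ Finset.univ.filter (fun j : Fin s => (j : ℕ) < c), f j ≤
      l * ∑ j ∈ Finset.univ.filter (fun j : Fin s => (j : ℕ) < c), f j / l + c * (l - 1) := by
  have hcard : (Finset.univ.filter (fun j : Fin s => (j : ℕ) < c)).card ≤ c := by
    simpa using Finset.card_le_card_of_injOn (t := Finset.range c) (fun j : Fin s => (j : ℕ))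
      (by intro j hj; simpa using hj) Fin.val_injective.injOn
  calc ∑ j ∈ Finset.univ.filter (fun j : Fin s => (j : ℕ) < c), f j
      ≤ ∑ j ∈ Finset.univ.filter (fun j : Fin s => (j : ℕ) < c), (l * (f j / l) + (l - 1)) := by
        refine Finset.sum_le_sum fun j _ => ?_
        have := Nat.div_add_mod (f j) l
        have := Nat.mod_lt (f j) hl
        omega
    _ ≤ _ := by
        rw [Finset.sum_add_distrib, ← Finset.mul_sum, Finset.sum_const, smul_eq_mul]
        gcongr


/-- With `h = bs - a + 1`, `c₀ = s - ⌊(a-1)/b⌋`,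
`μₐ⁰ = a - b(s - c₀)`, `μ̂_c = μₐ⁰ + b(c - c₀)` and `m' = ℓ(h + m - 1) - h + k`:
if `λ₁ ≤ ⋯ ≤ λ_s` are nonnegative integers with `λ₁ + ⋯ + λ_c ≥ m'·μ̂_c` for every
`c₀ ≤ c ≤ h`, then `⌊λ₁/ℓ⌋ + ⋯ + ⌊λ_c/ℓ⌋ ≥ m·μ̂_c` for every `c₀ ≤ c ≤ h`. -/
theorem floor_div_partial_sums (s a b : ℕ) (hs : 1 ≤ s) (hb : 2 ≤ b)
    (ha1 : (b - 1) * s + 1 < a) (ha2 : a < b * s)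
    (h c₀ μ₀ : ℕ) (hh : h = b * s - a + 1) (hc₀ : c₀ = s - (a - 1) / b)
    (hμ₀ : μ₀ = a - b * (s - c₀))
    (k l m : ℕ) (hk : 0 < k) (hl : 0 < l) (hm : 0 < m)
    (lam : Fin s → ℕ) (hmono : Monotone lam)
    (hsum : ∀ c : ℕ, c₀ ≤ c → c ≤ h →
      (l * (h + m - 1) - h + k) * (μ₀ + b * (c - c₀)) ≤
        ∑ j ∈ Finset.univ.filter (fun j : Fin s => (j : ℕ) < c), lam j) :
    ∀ c : ℕ, c₀ ≤ c → c ≤ h →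
      m * (μ₀ + b * (c - c₀)) ≤
        ∑ j ∈ Finset.univ.filter (fun j : Fin s => (j : ℕ) < c), lam j / l := by
  intro c hc hch
  have hμpos : 1 ≤ μ₀ := by
    have hq : b * (s - c₀) ≤ a - 1 :=
      (Nat.mul_le_mul_left b (hc₀ ▸ tsub_tsub_le : s - c₀ ≤ (a - 1) / b)).trans (Nat.mul_div_le _ _)
    omega
  have hS := (hsum c hc hch).trans (sum_filter_val_lt_le_mul_sum_div lam hl c)
  set F := ∑ j ∈ Finset.univ.filter (fun j : Fin s => (j : ℕ) < c), lam j / l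
  have hμ : 1 ≤ μ₀ + b * (c - c₀) := by omega
  generalize μ₀ + b * (c - c₀) = μ at hS hμ ⊢
  have hpos : 1 ≤ h := by omega
  clear_value F
  clear hsum hh hmono
  obtain ⟨l, rfl⟩ := Nat.exists_eq_add_of_le' hl
  obtain ⟨m, rfl⟩ := Nat.exists_eq_add_of_le' hm
  obtain ⟨k, rfl⟩ := Nat.exists_eq_add_of_le' hk
  obtain ⟨h, rfl⟩ := Nat.exists_eq_add_of_le' hpos
  have hm' : (l + 1) * (h + 1 + (m + 1) - 1) - (h + 1) + (k + 1) =
      (l + 1) * (m + 1) + l * h + k := by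
    have : (l + 1) * (h + 1 + (m + 1) - 1) = (l + 1) * (m + 1) + l * h + h := by
      rw [Nat.add_sub_assoc (by omega), Nat.add_sub_cancel]
      ring
    have : 1 ≤ (l + 1) * (m + 1) := Nat.mul_pos hl hm
    omega
  rw [hm', Nat.add_sub_cancel] at hS
  by_contra! hF
  have h₁ : (l + 1) * (F + 1) ≤ (l + 1) * ((m + 1) * μ) := Nat.mul_le_mul_left _ hF
  have h₂ : (l * h + k) * 1 ≤ (l * h + k) * μ := Nat.mul_le_mul_left _ hμ
  have h₃ : c * l ≤ (h + 1) * l := Nat.mul_le_mul_right _ hch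
  nlinarith
end
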